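/- Assume A and B. For every stationary multi-strategy φ ∈ Φ, every player i ∈ N, and every (history-dependent) strategy π_i ∈ Π_i, there exists a stationary strategy σ_i ∈ Φ_i such that J_i^ℓ([φ_{-i},σ_i]) = J_i^ℓ([φ_{-i},π_i]) for all ℓ ∈ L_0. In particular, if π_i ∈ Δ_i(φ_{-i}), then σ_i ∈ Δ_i(φ_{-i}). -/

import Mathlib

open MeasureTheory ProbabilityTheory Filter Topology
open scoped ENNReal NNReal

namespace CSGame

/-- The joint action space of the players. -/
abbrev JA {n : ℕ} (A : Fin n → Type) : Type := (i : Fin n) → A i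

/-- The data of a constrained discounted stochastic Markov game:
countable state space `X`, Borel action spaces `A i` with compact admissible
action sets `As i x`, transition probability `p`, initial distribution `η`,
discount factor `α`, cost/constraint functions `c i ℓ` (`ℓ = 0` is the cost,
`ℓ ∈ L = {1,…,l}` are the constraints) and constraint bounds `κ i ℓ`. -/
structure GameData (n l : ℕ) (X : Type) (A : Fin n → Type)
    [MeasurableSpace X] [∀ i, MeasurableSpace (A i)] [∀ i, TopologicalSpace (A i)] where
  As : (i : Fin n) → X → Set (A i)
  p : X → JA A → Measure X
  η : Measure X
  α : ℝ
  c : Fin n → Fin (l + 1) → X → JA A → ℝ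
  κ : Fin n → Fin (l + 1) → ℝ
  hAs_ne : ∀ i x, (As i x).Nonempty
  hAs_cpt : ∀ i x, IsCompact (As i x)
  hp : ∀ x a, IsProbabilityMeasure (p x a)
  hpm : ∀ x y, Measurable fun a => p x a {y}
  hη : IsProbabilityMeasure η
  hα0 : 0 < α
  hα1 : α < 1
  hc : ∀ i ℓ x, Measurable (c i ℓ x)

variable {n l : ℕ}
variable {X : Type} [Countable X] [MeasurableSpace X] [DiscreteMeasurableSpace X]
  [TopologicalSpace X] [DiscreteTopology X] [BorelSpace X] [SecondCountableTopology X]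
variable {A : Fin n → Type} [∀ i, MeasurableSpace (A i)] [∀ i, TopologicalSpace (A i)]
  [∀ i, PolishSpace (A i)] [∀ i, BorelSpace (A i)]

/-- The set of feasible action profiles in state `x` (the section of `𝕂` at `x`). -/
def jointSet (G : GameData n l X A) (x : X) : Set (JA A) :=
  Set.univ.pi fun i => G.As i x

/-- Histories of the game: `Hist X AA t` records the initial state and `t`
state-action transitions, ending with the current state (this is `H^{t+1}`). -/
def Hist (X AA : Type) : ℕ → Type
  | 0 => X
  | t + 1 => Hist X AA t × AA × X

noncomputable instance histMS (X AA : Type) [MeasurableSpace X] [MeasurableSpace AA] :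
    ∀ t, MeasurableSpace (Hist X AA t)
  | 0 => inferInstanceAs (MeasurableSpace X)
  | t + 1 =>
      letI := histMS X AA t
      inferInstanceAs (MeasurableSpace (Hist X AA t × AA × X))

/-- The current (last) state of a history. -/
def lastState (X AA : Type) : ∀ t, Hist X AA t → X
  | 0, h => h
  | _ + 1, h => h.2.2

theorem measurable_lastState (X AA : Type) [MeasurableSpace X] [MeasurableSpace AA] :
    ∀ t, Measurable (lastState X AA t)
  | 0 => measurable_id
  | _ + 1 => measurable_snd.comp measurable_snd

variable (G : GameData n l X A)

/-- A (history dependent, randomised) strategy of player `i`: a sequence of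
transition probabilities from histories to the action space of player `i`,
concentrated on the admissible action set at the current state. -/
structure Strategy (i : Fin n) where
  f : ∀ t, Hist X (JA A) t → ProbabilityMeasure (A i)
  meas : ∀ t (s : Set (A i)), MeasurableSet s →
    Measurable fun h => (f t h : Measure (A i)) s
  supp : ∀ t h, f t h (G.As i (lastState X (JA A) t h)) = 1

/-- A stationary strategy of player `i`: a transition probability from states to
actions, concentrated on the admissible action set. -/
def Stat (i : Fin n) : Type :=
  {φ : X → ProbabilityMeasure (A i) // ∀ x, φ x (G.As i x) = 1}

noncomputable instance (i : Fin n) : TopologicalSpace (Stat G i) :=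
  inferInstanceAs (TopologicalSpace
    {φ : X → ProbabilityMeasure (A i) // ∀ x, φ x (G.As i x) = 1})

/-- Multi-strategies: one strategy for each player. -/
abbrev MultiStrategy : Type _ := ∀ i, Strategy G i

/-- Stationary multi-strategies (the set `Φ`). -/
abbrev StatProfile : Type _ := ∀ i, Stat G i

noncomputable instance : TopologicalSpace (StatProfile G) :=
  inferInstanceAs (TopologicalSpace (∀ i, Stat G i))

/-- The strategy induced by a stationary strategy. -/
noncomputable def ofStat (i : Fin n) (φ : Stat G i) : Strategy G i where
  f := fun t h => φ.1 (lastState X (JA A) t h)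
  meas := fun t _s _hs =>
    (Measurable.of_discrete (f := fun x => (φ.1 x : Measure (A i)) _s)).comp
      (measurable_lastState X (JA A) t)
  supp := fun t h => φ.2 _

/-- The multi-strategy induced by a stationary multi-strategy. -/
noncomputable def ofStatAll (φ : StatProfile G) : MultiStrategy G :=
  fun i => ofStat G i (φ i)

/-- `[π_{-i}, σ]` : player `i` deviates to `σ`, the others keep `π`. -/
noncomputable def combine (π : MultiStrategy G) (i : Fin n) (σ : Strategy G i) :
    MultiStrategy G :=
  Function.update π i σ

/-- `[φ_{-i}, γ]` for stationary profiles. -/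
noncomputable def updStat (φ : StatProfile G) (i : Fin n) (γ : Stat G i) :
    StatProfile G :=
  Function.update φ i γ

/-- The joint (product) distribution of the players' actions after history `h`. -/
noncomputable def jointLaw (π : MultiStrategy G) (t : ℕ) (h : Hist X (JA A) t) :
    Measure (JA A) :=
  Measure.pi fun i => ((π i).f t h : Measure (A i))

/-- The distribution of histories of length `t` under the multi-strategy `π`,
the transition probability `G.p` and the initial distribution `η'`
(the finite-dimensional marginals of the Ionescu–Tulcea measure `P^π_{η'}`). -/
noncomputable def histMeas (η' : Measure X) (π : MultiStrategy G) :
    ∀ t, Measure (Hist X (JA A) t)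
  | 0 => η'
  | t + 1 =>
      (histMeas η' π t).bind fun h =>
        (jointLaw G π t h).bind fun a =>
          (G.p (lastState X (JA A) t h) a).map fun y =>
            (show Hist X (JA A) (t + 1) from (h, a, y))

/-- Expected value of `f (x^{t+1}, a^{t+1})` under `π` (states enumerated from `1`
in the paper, from `0` here). -/
noncomputable def stageExp (η' : Measure X) (π : MultiStrategy G) (t : ℕ)
    (f : X → JA A → ℝ) : ℝ :=
  ∫ h, (∫ a, f (lastState X (JA A) t h) a ∂(jointLaw G π t h)) ∂(histMeas G η' π t)

/-- The expected discounted cost functional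
`J(π) = (1-α) E^π_{η'} [∑_{t≥1} α^{t-1} f(x^t,a^t)]`. -/
noncomputable def Jfun (η' : Measure X) (f : X → JA A → ℝ) (π : MultiStrategy G) : ℝ :=
  (1 - G.α) * ∑' t : ℕ, G.α ^ t * stageExp G η' π t f

/-- `J_i^ℓ(π)` of the paper. -/
noncomputable def J (i : Fin n) (ℓ : Fin (l + 1)) (π : MultiStrategy G) : ℝ :=
  Jfun G G.η (G.c i ℓ) π

/-- `π_i ∈ Δ_i(π_{-i})` : all constraints of player `i` are satisfied. -/
def Feas (i : Fin n) (π : MultiStrategy G) : Prop :=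
  ∀ ℓ : Fin (l + 1), ℓ ≠ 0 → J G i ℓ π ≤ G.κ i ℓ

/-- Expectation of `w(x^{t+1})` (as an extended nonnegative real). -/
noncomputable def wStateExp (η' : Measure X) (π : MultiStrategy G) (t : ℕ)
    (w : X → ℝ) : ℝ≥0∞ :=
  ∫⁻ h, ENNReal.ofReal (w (lastState X (JA A) t h)) ∂(histMeas G η' π t)

/-- Assumption A(i): continuity of the transition probability in the actions. -/
def AssumptionA1 : Prop :=
  ∀ x y, ContinuousOn (fun a => G.p x a {y}) (jointSet G x)

/-- Assumption A: continuity of the transition probability and of the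
cost/constraint functions in the actions. -/
def AssumptionA : Prop :=
  AssumptionA1 G ∧ ∀ i ℓ x, ContinuousOn (G.c i ℓ x) (jointSet G x)

/-- Assumption B for the weight function `w`: `w ≥ 1` bounds all the costs on `𝕂`,
the discounted tails `sup_π (1-α) E^π_η[∑_{t≥k} α^{t-1} w(x^t)]` vanish as `k → ∞`,
and for each stage `t` the family `{w(x^t)}` is uniformly integrable over all
multi-strategies. -/
def AssumptionB (w : X → ℝ) : Prop :=
  (∀ x, 1 ≤ w x) ∧
  (∀ i ℓ x a, a ∈ jointSet G x → |G.c i ℓ x a| ≤ w x) ∧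
  Tendsto (fun k : ℕ => ⨆ π : MultiStrategy G,
      ENNReal.ofReal (1 - G.α) *
        ∑' t : ℕ, ENNReal.ofReal G.α ^ (k + t) * wStateExp G G.η π (k + t) w)
    atTop (𝓝 0) ∧
  ∀ t : ℕ, Tendsto (fun k : ℕ => ⨆ π : MultiStrategy G,
      ∫⁻ h in {h | (k : ℝ) ≤ w (lastState X (JA A) t h)},
        ENNReal.ofReal (w (lastState X (JA A) t h)) ∂(histMeas G G.η π t))
    atTop (𝓝 0)

/-- Assumption C (Slater condition). -/
def AssumptionC : Prop :=
  ∀ (φ : StatProfile G) (i : Fin n), ∃ π : Strategy G i,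
    ∀ ℓ : Fin (l + 1), ℓ ≠ 0 → J G i ℓ (combine G (ofStatAll G φ) i π) < G.κ i ℓ

/-- Assumption D: the initial distribution charges every state. -/
def AssumptionD : Prop :=
  ∀ x : X, 0 < G.η {x}

/-- Assumption W (weighted-norm conditions of Wessels). -/
def AssumptionW (w : X → ℝ) : Prop :=
  (∀ x, 1 ≤ w x) ∧
  (∀ i ℓ x a, a ∈ jointSet G x → |G.c i ℓ x a| ≤ w x) ∧
  (∃ δ : ℝ, 1 ≤ δ ∧ δ * G.α < 1 ∧ ∀ x a, a ∈ jointSet G x →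
      ∫⁻ y, ENNReal.ofReal (w y) ∂(G.p x a) ≤ ENNReal.ofReal (δ * w x)) ∧
  (∀ x, ContinuousOn (fun a => ∫⁻ y, ENNReal.ofReal (w y) ∂(G.p x a)) (jointSet G x)) ∧
  (∫⁻ y, ENNReal.ofReal (w y) ∂G.η) < ⊤

/-- All cost and constraint functions are bounded. -/
def BoundedCosts : Prop :=
  ∀ i (ℓ : Fin (l + 1)), ∃ C : ℝ, ∀ x a, |G.c i ℓ x a| ≤ C

/-- A stationary multi-strategy `φ` is a Nash equilibrium of the constrained game:
it is feasible, and no player can lower his discounted cost by a unilateral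
deviation to any (history dependent) strategy satisfying his constraints. -/
def IsNashStat (φ : StatProfile G) : Prop :=
  (∀ i, Feas G i (ofStatAll G φ)) ∧
  ∀ (i : Fin n) (σ : Strategy G i), Feas G i (combine G (ofStatAll G φ) i σ) →
    J G i 0 (ofStatAll G φ) ≤ J G i 0 (combine G (ofStatAll G φ) i σ)

section Occupation

/-- A correlated strategy of the players. -/
structure CorrStrategy where
  f : ∀ t, Hist X (JA A) t → ProbabilityMeasure (JA A)
  meas : ∀ t (s : Set (JA A)), MeasurableSet s →
    Measurable fun h => (f t h : Measure (JA A)) s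
  supp : ∀ t h, f t h (jointSet G (lastState X (JA A) t h)) = 1

/-- History distributions under a correlated strategy. -/
noncomputable def histMeasC (π : CorrStrategy G) : ∀ t, Measure (Hist X (JA A) t)
  | 0 => G.η
  | t + 1 =>
      (histMeasC π t).bind fun h =>
        ((π.f t h : Measure (JA A))).bind fun a =>
          (G.p (lastState X (JA A) t h) a).map fun y =>
            (show Hist X (JA A) (t + 1) from (h, a, y))

/-- The occupation measure `ρ(K') = (1-α) E^π_η [∑_{t≥1} α^{t-1} 1_{K'}(x^t,a^t)]`
of a correlated strategy, as a measure on the state–action pairs. -/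
noncomputable def occ (π : CorrStrategy G) : Measure (X × JA A) :=
  ENNReal.ofReal (1 - G.α) •
    Measure.sum fun t : ℕ => ENNReal.ofReal G.α ^ t •
      ((histMeasC G π t).bind fun h =>
        (π.f t h : Measure (JA A)).map fun a => (lastState X (JA A) t h, a))

/-- The set `𝓜` of occupation measures of correlated strategies. -/
def OccSet : Set (ProbabilityMeasure (X × JA A)) :=
  {ρ | ∃ π : CorrStrategy G, (ρ : Measure (X × JA A)) = occ G π}

/-- Projection of a state–action pair onto the coordinates of player `i`. -/
def projAct (i : Fin n) : X × JA A → X × A i := fun q => (q.1, q.2 i)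

/-- The set `𝓜_i` of statewise projections of occupation measures onto `𝕂_i`. -/
def MiSet (i : Fin n) : Set (ProbabilityMeasure (X × A i)) :=
  {μ | ∃ ρ ∈ OccSet G, (μ : Measure (X × A i)) = (ρ : Measure (X × JA A)).map (projAct i)}

/-- The marginal `μ̂(x) = μ({x} × A_i(x))`. -/
noncomputable def marg (i : Fin n) (μ : ProbabilityMeasure (X × A i)) (x : X) : ℝ≥0∞ :=
  (μ : Measure (X × A i)) ({x} ×ˢ G.As i x)

/-- `μ = μ̂ φ` : `φ` disintegrates `μ`, i.e. `μ({x} × B) = φ(B|x) μ̂(x)`. -/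
def Disint (i : Fin n) (μ : ProbabilityMeasure (X × A i)) (φ : Stat G i) : Prop :=
  ∀ x (B : Set (A i)), MeasurableSet B → B ⊆ G.As i x →
    (μ : Measure (X × A i)) ({x} ×ˢ B) = (φ.1 x B : ℝ≥0∞) * marg G i μ x

/-- The occupation measure on state–action pairs of a multi-strategy. -/
noncomputable def occMulti (η' : Measure X) (π : MultiStrategy G) : Measure (X × JA A) :=
  ENNReal.ofReal (1 - G.α) •
    Measure.sum fun t : ℕ => ENNReal.ofReal G.α ^ t •
      ((histMeas G η' π t).bind fun h =>
        (jointLaw G π t h).map fun a => (lastState X (JA A) t h, a))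

end Occupation

section COP

/-- The product distribution on action profiles in state `x` in which player `i`
plays the fixed action `ai` and every player `j ≠ i` plays `φ j`. -/
noncomputable def statJoint (φ : StatProfile G) (i : Fin n) (x : X) (ai : A i) :
    Measure (JA A) :=
  Measure.pi fun j =>
    if h : j = i then Measure.dirac (cast (congrArg A h.symm) ai)
    else ((φ j).1 x : Measure (A j))

/-- `c_i^ℓ(x, [φ_{-i}(x), a_i])`. -/
noncomputable def cbar (φ : StatProfile G) (i : Fin n) (ℓ : Fin (l + 1)) (x : X)
    (ai : A i) : ℝ :=
  ∫ a, G.c i ℓ x a ∂(statJoint G φ i x ai)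

/-- `p(y | x, [φ_{-i}(x), a_i])`. -/
noncomputable def pbar (φ : StatProfile G) (i : Fin n) (y x : X) (ai : A i) : ℝ≥0∞ :=
  ∫⁻ a, G.p x a {y} ∂(statJoint G φ i x ai)

/-- Feasibility in the constrained optimisation problem `COP(φ_{-i})`:
`μ ∈ Pr(𝕂_i)` satisfies the constraint inequalities and the characteristic
equations of occupation measures. -/
def COPFeasible (φ : StatProfile G) (i : Fin n)
    (μ : ProbabilityMeasure (X × A i)) : Prop :=
  (μ : Measure (X × A i)) {q : X × A i | q.2 ∈ G.As i q.1} = 1 ∧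
  (∀ ℓ : Fin (l + 1), ℓ ≠ 0 →
    ∫ q : X × A i, cbar G φ i ℓ q.1 q.2 ∂(μ : Measure (X × A i)) ≤ G.κ i ℓ) ∧
  ∀ x : X, (μ : Measure (X × A i)) ({x} ×ˢ G.As i x) =
    ENNReal.ofReal (1 - G.α) * G.η {x} +
      ENNReal.ofReal G.α *
        ∫⁻ q : X × A i, pbar G φ i x q.1 q.2 ∂(μ : Measure (X × A i))

/-- The objective of `COP(φ_{-i})`. -/
noncomputable def COPObj (φ : StatProfile G) (i : Fin n)
    (μ : ProbabilityMeasure (X × A i)) : ℝ :=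
  ∫ q : X × A i, cbar G φ i 0 q.1 q.2 ∂(μ : Measure (X × A i))

/-- The solution set `𝓞_i(φ_{-i})` of `COP(φ_{-i})`. -/
def COPSol (φ : StatProfile G) (i : Fin n) : Set (ProbabilityMeasure (X × A i)) :=
  {μ | COPFeasible G φ i μ ∧
    ∀ ν, COPFeasible G φ i ν → COPObj G φ i μ ≤ COPObj G φ i ν}

end COP

section Perturbed

/-- `η̃` is a probability measure charging exactly the `η`-null states `X_0`. -/
def IsPerturb (ηt : Measure X) : Prop :=
  IsProbabilityMeasure ηt ∧ (∀ x, G.η {x} = 0 → 0 < ηt {x}) ∧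
    ∀ x, G.η {x} ≠ 0 → ηt {x} = 0

/-- The perturbed initial distribution `η(m) = (1 - 1/m) η + (1/m) η̃`. -/
noncomputable def etam (ηt : Measure X) (m : ℕ) : Measure X :=
  ENNReal.ofReal (1 - 1 / (m : ℝ)) • G.η + ENNReal.ofReal (1 / (m : ℝ)) • ηt

/-- The truncation `c_i^{ℓ,m}` of `c_i^ℓ` at the level `√m`. -/
noncomputable def ctrunc (i : Fin n) (ℓ : Fin (l + 1)) (m : ℕ) (x : X) (a : JA A) : ℝ :=
  max (-Real.sqrt m) (min (G.c i ℓ x a) (Real.sqrt m))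

/-- `J_i^{ℓ,η(m)}`: discounted cost with truncated costs and perturbed initial
distribution. -/
noncomputable def Jm (ηt : Measure X) (m : ℕ) (i : Fin n) (ℓ : Fin (l + 1))
    (π : MultiStrategy G) : ℝ :=
  Jfun G (etam G ηt m) (ctrunc G i ℓ m) π

/-- The perturbed constraint bounds `κ_i^{ℓ,m} = (1 - 1/m) κ_i^ℓ + 1/√m`. -/
noncomputable def kappam (i : Fin n) (ℓ : Fin (l + 1)) (m : ℕ) : ℝ :=
  (1 - 1 / (m : ℝ)) * G.κ i ℓ + 1 / Real.sqrt m

/-- `π_i ∈ Δ_i^m(π_{-i})` : the constraints of the `m`-CSG hold. -/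
def FeasM (ηt : Measure X) (m : ℕ) (i : Fin n) (π : MultiStrategy G) : Prop :=
  ∀ ℓ : Fin (l + 1), ℓ ≠ 0 → Jm G ηt m i ℓ π ≤ kappam G i ℓ m

end Perturbed

end CSGame

open CSGame

namespace CSGame

variable {n l : ℕ}
variable {X : Type} [Countable X] [MeasurableSpace X] [DiscreteMeasurableSpace X]
  [TopologicalSpace X] [DiscreteTopology X] [BorelSpace X] [SecondCountableTopology X]
variable {A : Fin n → Type} [∀ i, MeasurableSpace (A i)] [∀ i, TopologicalSpace (A i)]
  [∀ i, PolishSpace (A i)] [∀ i, BorelSpace (A i)]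
variable (G : GameData n l X A)

theorem meas_map_mk {α β : Type} [MeasurableSpace α] [MeasurableSpace β] (κ : Kernel α β)
    [IsSFiniteKernel κ] : Measurable fun a => (κ a).map (Prod.mk a) := by
  refine Measure.measurable_of_measurable_coe _ fun s hs => ?_
  have : ∀ a, (κ a).map (Prod.mk a) s = κ a (Prod.mk a ⁻¹' s) := fun a =>
    Measure.map_apply measurable_prodMk_left hs
  simp only [this]
  exact Kernel.measurable_kernel_prodMk_left hs

theorem bind_map_mk {α β : Type} [MeasurableSpace α] [MeasurableSpace β] (κ : Kernel α β)
    [IsSFiniteKernel κ] (μ : Measure α) [SFinite μ] :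
    μ.bind (fun a => (κ a).map (Prod.mk a)) = μ ⊗ₘ κ := by
  ext s hs
  rw [Measure.bind_apply hs (meas_map_mk κ).aemeasurable, Measure.compProd_apply hs]
  refine lintegral_congr fun a => Measure.map_apply measurable_prodMk_left hs

/-- The joint law as a Markov kernel. -/
noncomputable def jointKer (π : MultiStrategy G) (t : ℕ) : Kernel (Hist X (JA A) t) (JA A) where
  toFun := jointLaw G π t
  measurable' := by
    have : ∀ h, IsProbabilityMeasure (jointLaw G π t h) := fun h => by
      unfold jointLaw; infer_instance
    refine Measurable.measure_of_isPiSystem_of_isProbabilityMeasure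
      generateFrom_pi.symm isPiSystem_pi ?_
    rintro _ ⟨B, hB, rfl⟩
    simp only [jointLaw, Measure.pi_pi]
    refine Finset.measurable_prod _ fun j _ => (π j).meas t _ (hB j trivial)

instance jointKer_markov (π : MultiStrategy G) (t : ℕ) : IsMarkovKernel (jointKer G π t) :=
  ⟨fun h => by
    change IsProbabilityMeasure (jointLaw G π t h)
    unfold jointLaw; infer_instance⟩

/-- The transition probability as a Markov kernel. -/
noncomputable def transKer : Kernel (X × JA A) X where
  toFun := fun q => G.p q.1 q.2
  measurable' := by
    refine Measure.measurable_of_measurable_coe _ fun s _ => ?_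
    refine measurable_from_prod_countable_right fun x => ?_
    have : ∀ a, G.p x a s = ∑' y : s, G.p x a {(y : X)} := fun a => by
      rw [← measure_biUnion s.to_countable]
      · simp
      · intro a _ b _ hab
        simpa using hab
      · intros; exact measurableSet_singleton _
    simp only [this]
    exact Measurable.tsum fun y => G.hpm x y

instance transKer_markov : IsMarkovKernel (transKer G) := ⟨fun q => G.hp q.1 q.2⟩

/-- The one step kernel. -/
noncomputable def stepKer (π : MultiStrategy G) (t : ℕ) :
    Kernel (Hist X (JA A) t) (JA A × X) :=
  jointKer G π t ⊗ₖ (transKer G).comap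
    (fun q : Hist X (JA A) t × JA A => (lastState X (JA A) t q.1, q.2))
    (((measurable_lastState X (JA A) t).comp measurable_fst).prodMk measurable_snd)

instance stepKer_markov (π : MultiStrategy G) (t : ℕ) : IsMarkovKernel (stepKer G π t) := by
  unfold stepKer; infer_instance

theorem step_eq (π : MultiStrategy G) (t : ℕ) (h : Hist X (JA A) t) :
    ((jointLaw G π t h).bind fun a =>
          (G.p (lastState X (JA A) t h) a).map fun y =>
            (show Hist X (JA A) (t + 1) from (h, a, y))) =
    ((stepKer G π t h).map (Prod.mk h) : Measure (Hist X (JA A) t × JA A × X)) := by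
  let κ : Kernel (JA A) X := (transKer G).comap
    (fun a => (lastState X (JA A) t h, a)) measurable_prodMk_left
  have h1 : ∀ a, ((G.p (lastState X (JA A) t h) a).map fun y =>
            (show Hist X (JA A) (t + 1) from (h, a, y))) =
      (((κ a).map (Prod.mk a)).map (Prod.mk h) : Measure (Hist X (JA A) t × JA A × X)) := by
    intro a
    rw [Measure.map_map measurable_prodMk_left measurable_prodMk_left]
    rfl
  change ((jointKer G π t h).bind fun a => _) = _
  simp only [h1]
  refine Measure.ext fun (s : Set (Hist X (JA A) t × JA A × X)) (hs : MeasurableSet s) => ?_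
  have hm : Measurable fun a => ((κ a).map (Prod.mk a)).map (Prod.mk h) :=
    (Measure.measurable_map _ measurable_prodMk_left).comp (meas_map_mk κ)
  change _ = ((stepKer G π t h).map (Prod.mk h) : Measure (Hist X (JA A) t × JA A × X)) s
  refine (Measure.bind_apply (β := Hist X (JA A) t × JA A × X) hs hm.aemeasurable).trans ?_
  refine Eq.trans ?_ (Measure.map_apply (β := Hist X (JA A) t × JA A × X)
    measurable_prodMk_left hs).symm
  rw [stepKer, Kernel.compProd_apply (measurable_prodMk_left hs)]
  refine lintegral_congr fun a => ?_
  rw [Measure.map_apply measurable_prodMk_left hs,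
    Measure.map_apply measurable_prodMk_left (measurable_prodMk_left hs)]
  rfl

theorem histMeas_succ_aux (η' : Measure X) (π : MultiStrategy G) (t : ℕ)
    [SFinite (histMeas G η' π t)] :
    histMeas G η' π (t + 1) = (histMeas G η' π t ⊗ₘ stepKer G π t) := by
  rw [← bind_map_mk]
  change Measure.bind _ _ = _
  simp only [step_eq]
  rfl

instance histMeas_prob (η' : Measure X) [IsProbabilityMeasure η'] (π : MultiStrategy G) :
    ∀ t, IsProbabilityMeasure (histMeas G η' π t)
  | 0 => ‹_›
  | t + 1 => by
    have := histMeas_prob η' π t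
    rw [histMeas_succ_aux]
    change IsProbabilityMeasure (histMeas G η' π t ⊗ₘ stepKer G π t)
    infer_instance

instance eta_prob : IsProbabilityMeasure G.η := G.hη

/-- Law of the current state. -/
noncomputable def stLaw (π : MultiStrategy G) (t : ℕ) : Measure X :=
  (histMeas G G.η π t).map (lastState X (JA A) t)

instance stLaw_prob (π : MultiStrategy G) (t : ℕ) : IsProbabilityMeasure (stLaw G π t) :=
  Measure.isProbabilityMeasure_map (measurable_lastState X (JA A) t).aemeasurable

theorem meas_sa (t : ℕ) : Measurable (fun q : Hist X (JA A) t × JA A =>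
    (lastState X (JA A) t q.1, q.2)) :=
  ((measurable_lastState X (JA A) t).comp measurable_fst).prodMk measurable_snd

/-- Law of the state-action pair at stage `t`. -/
noncomputable def saLaw (π : MultiStrategy G) (t : ℕ) : Measure (X × JA A) :=
  (histMeas G G.η π t ⊗ₘ jointKer G π t).map
    (fun q : Hist X (JA A) t × JA A => (lastState X (JA A) t q.1, q.2))

instance saLaw_prob (π : MultiStrategy G) (t : ℕ) : IsProbabilityMeasure (saLaw G π t) :=
  Measure.isProbabilityMeasure_map (meas_sa t).aemeasurable

theorem lintegral_saLaw (π : MultiStrategy G) (t : ℕ) {f : X × JA A → ℝ≥0∞}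
    (hf : Measurable f) : ∫⁻ q, f q ∂saLaw G π t =
      ∫⁻ h, ∫⁻ a, f (lastState X (JA A) t h, a) ∂jointKer G π t h ∂histMeas G G.η π t := by
  rw [saLaw, lintegral_map hf (meas_sa t)]
  exact Measure.lintegral_compProd (hf.comp (meas_sa t))

theorem stLaw_eq (π : MultiStrategy G) (t : ℕ) : stLaw G π t = (saLaw G π t).map Prod.fst := by
  rw [saLaw, Measure.map_map measurable_fst (meas_sa t)]
  conv_lhs => rw [stLaw, ← Measure.fst_compProd (histMeas G G.η π t) (jointKer G π t)]
  rw [Measure.fst, Measure.map_map (measurable_lastState X (JA A) t) measurable_fst]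
  rfl

theorem stLaw_succ (π : MultiStrategy G) (t : ℕ) (s : Set X) :
    stLaw G π (t + 1) s = ∫⁻ q, transKer G q s ∂saLaw G π t := by
  have hs : MeasurableSet s := .of_discrete
  rw [lintegral_saLaw G π t (Kernel.measurable_coe _ hs), stLaw,
    Measure.map_apply (measurable_lastState X (JA A) _) hs, histMeas_succ_aux]
  have hms : MeasurableSet {q : Hist X (JA A) t × JA A × X | q.2.2 ∈ s} :=
    (measurable_snd.comp measurable_snd) hs
  refine (Measure.compProd_apply hms).trans ?_
  refine lintegral_congr fun h => ?_
  rw [stepKer, Kernel.compProd_apply (measurable_prodMk_left hms)]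
  rfl

/-- Unnormalised occupation measure. -/
noncomputable def occU (π : MultiStrategy G) : Measure (X × JA A) :=
  Measure.sum fun t : ℕ => ENNReal.ofReal G.α ^ t • saLaw G π t

/-- Unnormalised state occupation measure. -/
noncomputable def occX (π : MultiStrategy G) : Measure X :=
  Measure.sum fun t : ℕ => ENNReal.ofReal G.α ^ t • stLaw G π t

theorem occX_eq (π : MultiStrategy G) : occX G π = (occU G π).map Prod.fst := by
  rw [occU, occX, Measure.map_sum measurable_fst.aemeasurable]
  simp only [Measure.map_smul, stLaw_eq]

theorem occX_univ (π : MultiStrategy G) :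
    occX G π Set.univ = (1 - ENNReal.ofReal G.α)⁻¹ := by
  rw [occX, Measure.sum_apply _ MeasurableSet.univ, ← ENNReal.tsum_geometric]
  simp

instance occX_fin (π : MultiStrategy G) : IsFiniteMeasure (occX G π) :=
  ⟨by
    rw [occX_univ, ENNReal.inv_lt_top, tsub_pos_iff_lt]
    simpa using G.hα1⟩

instance occU_fin (π : MultiStrategy G) : IsFiniteMeasure (occU G π) :=
  ⟨by
    have := measure_lt_top (occX G π) Set.univ
    rwa [occX_eq, Measure.map_apply measurable_fst MeasurableSet.univ] at this⟩

theorem occX_fixed (π : MultiStrategy G) (s : Set X) :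
    occX G π s = G.η s + ENNReal.ofReal G.α * ∫⁻ q, transKer G q s ∂occU G π := by
  have hs : MeasurableSet s := .of_discrete
  rw [occX, occU, Measure.sum_apply _ hs, lintegral_sum_measure,
    tsum_eq_zero_add' ENNReal.summable, ← ENNReal.tsum_mul_left]
  congr 1
  · have : stLaw G π 0 = G.η := Measure.map_id
    simp [this]
  · refine tsum_congr fun t => ?_
    rw [lintegral_smul_measure, Measure.smul_apply, stLaw_succ, smul_eq_mul, smul_eq_mul, pow_succ']
    ring

theorem compare_aux (α : ℝ≥0∞) (m : ℕ → Measure X) (N η : Measure X) (T : X → Set X → ℝ≥0∞)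
    (h0 : m 0 = η) (hm : ∀ t s, m (t + 1) s = ∫⁻ x, T x s ∂m t)
    (hN : ∀ s, N s = η s + α * ∫⁻ x, T x s ∂N) (k : ℕ) :
    ∑ t ∈ Finset.range k, α ^ t • m t ≤ N := by
  induction k with
  | zero => simpa using Measure.zero_le N
  | succ k ih =>
    refine Measure.le_iff.2 fun s _ => ?_
    rw [hN, Finset.sum_range_succ', Measure.add_apply, pow_zero, one_smul, h0, add_comm]
    gcongr
    refine le_trans (le_of_eq ?_) (mul_le_mul_right (lintegral_mono' ih le_rfl) _)
    rw [lintegral_finsetSum_measure, Finset.mul_sum, Measure.finsetSum_apply]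
    refine Finset.sum_congr rfl fun t _ => ?_
    rw [lintegral_smul_measure, Measure.smul_apply, hm, smul_eq_mul, smul_eq_mul, pow_succ']
    ring

theorem jointLaw_set (π : MultiStrategy G) (t : ℕ) (h : Hist X (JA A) t) :
    jointLaw G π t h (jointSet G (lastState X (JA A) t h)) = 1 := by
  rw [jointLaw, jointSet, Measure.pi_pi]
  refine Finset.prod_eq_one fun j _ => ?_
  have := (π j).supp t h
  rw [← ProbabilityMeasure.ennreal_coeFn_eq_coeFn_toMeasure, this]
  rfl

theorem meas_As (i : Fin n) (x : X) : MeasurableSet (G.As i x) :=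
  (G.hAs_cpt i x).isClosed.measurableSet

theorem meas_joint : MeasurableSet {q : X × JA A | q.2 ∈ jointSet G q.1} := by
  have : Measurable fun q : X × JA A => (q.2 ∈ jointSet G q.1) :=
    measurable_from_prod_countable_right fun x =>
      measurableSet_setOf.1 (MeasurableSet.univ_pi fun j => meas_As G j x)
  exact measurableSet_setOf.2 this

theorem saLaw_supp (π : MultiStrategy G) (t : ℕ) :
    ∀ᵐ q ∂saLaw G π t, q.2 ∈ jointSet G q.1 := by
  rw [saLaw, ae_map_iff (meas_sa t).aemeasurable (meas_joint G)]
  refine (Measure.ae_compProd_iff (meas_sa t (meas_joint G))).2 ?_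
  refine Eventually.of_forall fun h => ?_
  have := jointLaw_set G π t h
  have hm : MeasurableSet (jointSet G (lastState X (JA A) t h)) :=
    MeasurableSet.univ_pi fun j => meas_As G j _
  exact (prob_compl_eq_zero_iff (μ := jointKer G π t h) hm).2 this

theorem occU_supp (π : MultiStrategy G) : ∀ᵐ q ∂occU G π, q.2 ∈ jointSet G q.1 := by
  rw [occU, Measure.ae_sum_iff' (meas_joint G)]
  exact fun t => Measure.ae_smul_measure (saLaw_supp G π t) _

theorem wexp_finite (w : X → ℝ) (hB : AssumptionB G w) (π : MultiStrategy G) (t : ℕ) :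
    wStateExp G G.η π t w < ⊤ := by
  obtain ⟨_, _, _, h⟩ := hB
  obtain ⟨k, hk⟩ := ((h t).eventually (gt_mem_nhds (zero_lt_one))).exists
  have hk := (le_iSup (fun π : MultiStrategy G =>
      ∫⁻ h in {h | (k : ℝ) ≤ w (lastState X (JA A) t h)},
        ENNReal.ofReal (w (lastState X (JA A) t h)) ∂(histMeas G G.η π t)) π).trans_lt hk
  have hms : MeasurableSet {h | (k : ℝ) ≤ w (lastState X (JA A) t h)} :=
    measurable_lastState X (JA A) t (MeasurableSet.of_discrete (s := {x | (k : ℝ) ≤ w x}))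
  rw [wStateExp, ← lintegral_add_compl _ hms]
  refine ENNReal.add_lt_top.2 ⟨hk.trans ENNReal.one_lt_top, ?_⟩
  refine (setLIntegral_mono (g := fun _ => ENNReal.ofReal k) measurable_const ?_).trans_lt ?_
  · intro h hh
    simp only [Set.mem_compl_iff, Set.mem_ofPred_eq, not_le] at hh
    exact ENNReal.ofReal_le_ofReal hh.le
  · rw [setLIntegral_const]
    exact ENNReal.mul_lt_top ENNReal.ofReal_lt_top (measure_lt_top _ _)

theorem wsum_finite (w : X → ℝ) (hB : AssumptionB G w) (π : MultiStrategy G) :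
    ∑' t : ℕ, ENNReal.ofReal G.α ^ t * wStateExp G G.η π t w < ⊤ := by
  obtain ⟨k, hk⟩ := (hB.2.2.1.eventually (gt_mem_nhds (zero_lt_one))).exists
  have hk := (le_iSup (fun π : MultiStrategy G =>
      ENNReal.ofReal (1 - G.α) *
        ∑' t : ℕ, ENNReal.ofReal G.α ^ (k + t) * wStateExp G G.η π (k + t) w) π).trans_lt hk
  have hfin : ∑' t : ℕ, ENNReal.ofReal G.α ^ (t + k) * wStateExp G G.η π (t + k) w ≠ ⊤ := by
    intro htop
    simp only [add_comm k, htop] at hk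
    rw [ENNReal.mul_top] at hk
    · simp at hk
    · simpa using G.hα1
  rw [← ENNReal.summable.sum_add_tsum_nat_add' (k := k)]
  refine ENNReal.add_lt_top.2 ⟨ENNReal.sum_lt_top.2 fun t _ => ?_, hfin.lt_top⟩
  exact ENNReal.mul_lt_top (by finiteness) (wexp_finite G w hB π t)

theorem lintegral_occU_w (w : X → ℝ) (π : MultiStrategy G) :
    ∫⁻ q, ENNReal.ofReal (w q.1) ∂occU G π =
      ∑' t : ℕ, ENNReal.ofReal G.α ^ t * wStateExp G G.η π t w := by
  rw [occU, lintegral_sum_measure]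
  refine tsum_congr fun t => ?_
  rw [lintegral_smul_measure, lintegral_saLaw, wStateExp]
  · simp
  · exact (Measurable.of_discrete (f := fun x => ENNReal.ofReal (w x))).comp measurable_fst

theorem integrable_c (w : X → ℝ) (hB : AssumptionB G w) (π : MultiStrategy G) (i : Fin n)
    (ℓ : Fin (l + 1)) : Integrable (fun q : X × JA A => G.c i ℓ q.1 q.2) (occU G π) := by
  have hm : Measurable (fun q : X × JA A => G.c i ℓ q.1 q.2) :=
    measurable_from_prod_countable_right fun x => G.hc i ℓ x
  refine ⟨hm.aestronglyMeasurable, ?_⟩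
  refine lt_of_le_of_lt ?_ (wsum_finite G w hB π)
  rw [← lintegral_occU_w]
  refine lintegral_mono_ae ?_
  filter_upwards [occU_supp G π] with q hq
  rw [Real.enorm_eq_ofReal_abs]
  exact ENNReal.ofReal_le_ofReal (hB.2.1 i ℓ q.1 q.2 hq)

theorem J_eq (w : X → ℝ) (hB : AssumptionB G w) (π : MultiStrategy G) (i : Fin n)
    (ℓ : Fin (l + 1)) : J G i ℓ π = (1 - G.α) * ∫ q, G.c i ℓ q.1 q.2 ∂occU G π := by
  have hm : Measurable (fun q : X × JA A => G.c i ℓ q.1 q.2) :=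
    measurable_from_prod_countable_right fun x => G.hc i ℓ x
  have hint := integrable_c G w hB π i ℓ
  rw [J, Jfun]
  congr 1
  rw [occU, integral_sum_measure hint]
  refine tsum_congr fun t => ?_
  have hpos : ENNReal.ofReal G.α ^ t ≠ 0 := pow_ne_zero _ (by simpa using G.hα0)
  have h1 : Integrable (fun q : X × JA A => G.c i ℓ q.1 q.2) (saLaw G π t) := by
    have := hint.mono_measure (Measure.le_sum _ t)
    rwa [integrable_smul_measure hpos (by finiteness)] at this
  rw [integral_smul_measure, stageExp, saLaw,
    integral_map (meas_sa t).aemeasurable hm.aestronglyMeasurable, Measure.integral_compProd]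
  · simp only [ENNReal.toReal_pow, ENNReal.toReal_ofReal G.hα0.le, smul_eq_mul]
    rfl
  · exact h1.comp_measurable (meas_sa t)

/-- Kernel of a stationary profile. -/
noncomputable def statKer (s : StatProfile G) : Kernel X (JA A) where
  toFun := fun x => Measure.pi fun j => ((s j).1 x : Measure (A j))
  measurable' := .of_discrete

instance statKer_markov (s : StatProfile G) : IsMarkovKernel (statKer G s) :=
  ⟨fun x => by
    change IsProbabilityMeasure (Measure.pi fun j => ((s j).1 x : Measure (A j)))
    infer_instance⟩

theorem saLaw_stat (s : StatProfile G) (t : ℕ) :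
    saLaw G (ofStatAll G s) t = stLaw G (ofStatAll G s) t ⊗ₘ statKer G s := by
  refine Measure.ext fun E hE => ?_
  rw [Measure.compProd_apply hE, stLaw, lintegral_map (Kernel.measurable_kernel_prodMk_left hE)
    (measurable_lastState X (JA A) t), saLaw, Measure.map_apply (meas_sa t) hE,
    Measure.compProd_apply (meas_sa t hE)]
  rfl

theorem occU_stat (s : StatProfile G) :
    occU G (ofStatAll G s) = occX G (ofStatAll G s) ⊗ₘ statKer G s := by
  refine Measure.ext fun E hE => ?_
  rw [Measure.compProd_apply hE, occU, occX, lintegral_sum_measure, Measure.sum_apply _ hE]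
  refine tsum_congr fun t => ?_
  rw [lintegral_smul_measure, Measure.smul_apply, saLaw_stat, Measure.compProd_apply hE]

theorem occX_unique (s : StatProfile G) (ψ : MultiStrategy G)
    (h : occU G ψ = occX G ψ ⊗ₘ statKer G s) : occX G (ofStatAll G s) = occX G ψ := by
  refine Measure.eq_of_le_of_measure_univ_eq ?_ (by rw [occX_univ, occX_univ])
  have key := compare_aux (ENNReal.ofReal G.α) (stLaw G (ofStatAll G s)) (occX G ψ) G.η
    (fun x E => ∫⁻ a, transKer G (x, a) E ∂statKer G s x) ?_ ?_ ?_
  · refine Measure.le_iff.2 fun E hE => ?_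
    rw [occX, Measure.sum_apply _ hE]
    refine ENNReal.tsum_le_of_sum_range_le fun k => ?_
    have := Measure.le_iff.1 (key k) E hE
    rwa [Measure.finsetSum_apply] at this
  · exact Measure.map_id
  · intro t E
    rw [stLaw_succ, saLaw_stat, Measure.lintegral_compProd (Kernel.measurable_coe _ .of_discrete)]
  · intro E
    rw [occX_fixed, h, Measure.lintegral_compProd (Kernel.measurable_coe _ .of_discrete)]

theorem occU_unique (s : StatProfile G) (ψ : MultiStrategy G)
    (h : occU G ψ = occX G ψ ⊗ₘ statKer G s) : occU G (ofStatAll G s) = occU G ψ := by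
  rw [occU_stat, occX_unique G s ψ h, h]

theorem combine_stat (φ : StatProfile G) (i : Fin n) (σ : Stat G i) :
    combine G (ofStatAll G φ) i (ofStat G i σ) = ofStatAll G (updStat G φ i σ) := by
  funext j
  by_cases h : j = i
  · subst h; simp [combine, updStat, ofStatAll]
  · simp [combine, updStat, ofStatAll, h]

theorem occX_singleton (ψ : MultiStrategy G) (x : X) :
    occX G ψ {x} = occU G ψ ({x} ×ˢ Set.univ) := by
  rw [occX_eq, Measure.map_apply measurable_fst (measurableSet_singleton x), Set.prod_univ]

theorem exists_cond (ψ : MultiStrategy G) (i : Fin n) (x : X) :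
    ∃ ν : ProbabilityMeasure (A i), ν (G.As i x) = 1 ∧ ∀ b : Set (A i), MeasurableSet b →
      occU G ψ ({x} ×ˢ (Function.eval i ⁻¹' b)) = occX G ψ {x} * (ν : Measure (A i)) b := by
  by_cases h0 : occX G ψ {x} = 0
  · obtain ⟨a, ha⟩ := G.hAs_ne i x
    refine ⟨⟨Measure.dirac a, inferInstance⟩, ?_, fun b _ => ?_⟩
    · apply ENNReal.coe_injective
      refine (ProbabilityMeasure.ennreal_coeFn_eq_coeFn_toMeasure _ _).trans ?_
      exact Measure.dirac_apply_of_mem ha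
    · rw [h0, zero_mul]
      rw [occX_singleton] at h0
      exact measure_mono_null (Set.prod_mono le_rfl (Set.subset_univ _)) h0
  · have htop : occX G ψ {x} ≠ ⊤ := measure_ne_top _ _
    let ν : Measure (A i) := (occX G ψ {x})⁻¹ •
      ((occU G ψ).restrict ({x} ×ˢ Set.univ)).map (fun q => q.2 i)
    have hpm : Measurable (fun q : X × JA A => q.2 i) :=
      (measurable_pi_apply i).comp measurable_snd
    have hν : ∀ b : Set (A i), MeasurableSet b →
        ν b = (occX G ψ {x})⁻¹ * occU G ψ ({x} ×ˢ (Function.eval i ⁻¹' b)) := by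
      intro b hb
      rw [Measure.smul_apply, Measure.map_apply hpm hb, Measure.restrict_apply (hpm hb),
        smul_eq_mul]
      congr 2
      ext q
      simp [and_comm]
    have hprob : IsProbabilityMeasure ν := ⟨by
      rw [hν _ MeasurableSet.univ, Set.preimage_univ, ← occX_singleton,
        ENNReal.inv_mul_cancel h0 htop]⟩
    refine ⟨⟨ν, hprob⟩, ?_, fun b hb => ?_⟩
    · apply ENNReal.coe_injective
      refine (ProbabilityMeasure.ennreal_coeFn_eq_coeFn_toMeasure _ _).trans ?_
      change ν _ = 1
      rw [hν _ (meas_As G i x), ← ENNReal.inv_mul_cancel h0 htop, occX_singleton]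
      congr 1
      refine measure_congr ?_
      filter_upwards [occU_supp G ψ] with q hq
      apply propext
      change (q.1 ∈ ({x} : Set X) ∧ q.2 i ∈ G.As i x) ↔ (q.1 ∈ ({x} : Set X) ∧ q.2 ∈ Set.univ)
      refine and_congr_right fun hx => ?_
      have := hq i trivial
      rw [Set.mem_singleton_iff.1 hx] at this
      simp [this]
    · change _ = _ * ν b
      rw [hν b hb, ← mul_assoc, ENNReal.mul_inv_cancel h0 htop, one_mul]

theorem occU_rect (φ : StatProfile G) (i : Fin n) (π : Strategy G i) (x : X)
    (B : ∀ j, Set (A j)) (hB : ∀ j, MeasurableSet (B j)) :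
    occU G (combine G (ofStatAll G φ) i π) ({x} ×ˢ Set.univ.pi B) =
      (∏ j ∈ Finset.univ.erase i, ((φ j).1 x : Measure (A j)) (B j)) *
      ∑' t : ℕ, ENNReal.ofReal G.α ^ t * ∫⁻ h in lastState X (JA A) t ⁻¹' {x},
        (π.f t h : Measure (A i)) (B i)
        ∂histMeas G G.η (combine G (ofStatAll G φ) i π) t := by
  have hP : MeasurableSet (Set.univ.pi B) := MeasurableSet.univ_pi hB
  have hR : MeasurableSet (({x} : Set X) ×ˢ Set.univ.pi B) := (measurableSet_singleton x).prod hP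
  rw [occU, Measure.sum_apply _ hR, ← ENNReal.tsum_mul_left]
  refine tsum_congr fun t => ?_
  have hl : MeasurableSet (lastState X (JA A) t ⁻¹' {x}) :=
    measurable_lastState X (JA A) t (measurableSet_singleton x)
  rw [Measure.smul_apply, smul_eq_mul, saLaw, Measure.map_apply (meas_sa t) hR, mul_left_comm]
  congr 1
  rw [← lintegral_const_mul _ (π.meas t _ (hB i))]
  refine (Measure.compProd_apply_prod hl hP).trans ?_
  refine setLIntegral_congr_fun hl fun h hh => ?_
  have hh : lastState X (JA A) t h = x := hh
  change Measure.pi _ _ = _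
  rw [Measure.pi_pi, ← Finset.prod_erase_mul _ _ (Finset.mem_univ i)]
  congr 1
  · refine Finset.prod_congr rfl fun j hj => ?_
    simp [combine, Finset.ne_of_mem_erase hj, ofStatAll, ofStat, hh]
  · simp [combine]

theorem ext_prod_countable {B : Type} [MeasurableSpace B] {μ ν : Measure (X × B)}
    [IsFiniteMeasure μ]
    (h : ∀ x (t : Set B), MeasurableSet t → μ ({x} ×ˢ t) = ν ({x} ×ˢ t)) : μ = ν := by
  refine Measure.ext_prod fun {s t} hs ht => ?_
  have : ∀ ρ : Measure (X × B), ∀ s : Set X,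
      (ρ.restrict (Set.univ ×ˢ t)).map Prod.fst s = ρ (s ×ˢ t) := fun ρ s => by
    rw [Measure.map_apply measurable_fst .of_discrete,
      Measure.restrict_apply (measurable_fst .of_discrete)]
    congr 1
    ext q
    simp
  rw [← this, ← this]
  congr 1
  refine Measure.ext_of_singleton fun x => ?_
  rw [this, this, h x t ht]

theorem occU_disint (φ : StatProfile G) (i : Fin n) (π : Strategy G i) :
    ∃ σ : Stat G i, occU G (combine G (ofStatAll G φ) i π) =
      occX G (combine G (ofStatAll G φ) i π) ⊗ₘ statKer G (updStat G φ i σ) := by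
  choose ν hν1 hν2 using exists_cond G (combine G (ofStatAll G φ) i π) i
  refine ⟨⟨ν, hν1⟩, ?_⟩
  refine ext_prod_countable fun x t ht => ?_
  set ψ := combine G (ofStatAll G φ) i π with hψ
  rw [Measure.compProd_apply_prod (measurableSet_singleton x) ht, lintegral_singleton, mul_comm]
  set s := updStat G φ i ⟨ν, hν1⟩ with hs
  have key : ((occU G ψ).restrict ({x} ×ˢ Set.univ)).map Prod.snd
      = occX G ψ {x} • statKer G s x := by
    have hap : ∀ t : Set (JA A), MeasurableSet t →
        ((occU G ψ).restrict ({x} ×ˢ Set.univ)).map Prod.snd t = occU G ψ ({x} ×ˢ t) := by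
      intro t ht
      rw [Measure.map_apply measurable_snd ht, Measure.restrict_apply (measurable_snd ht)]
      congr 1
      ext q
      simp [and_comm]
    refine ext_of_generate_finite _ generateFrom_pi.symm isPiSystem_pi ?_ ?_
    · rintro _ ⟨B, hB, rfl⟩
      have hB : ∀ j, MeasurableSet (B j) := fun j => hB j trivial
      rw [hap _ (MeasurableSet.univ_pi hB), Measure.smul_apply, smul_eq_mul]
      have h1 := hν2 x (B i) (hB i)
      have h2 : (Function.eval i ⁻¹' B i : Set (JA A)) =
          Set.univ.pi (Function.update (fun j => (Set.univ : Set (A j))) i (B i)) :=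
        Set.eval_preimage
      rw [h2, occU_rect] at h1
      · rw [hψ, occU_rect G φ i π x B hB]
        have h3 : ∏ j ∈ Finset.univ.erase i, ((φ j).1 x : Measure (A j))
            (Function.update (fun j => (Set.univ : Set (A j))) i (B i) j) = 1 := by
          refine Finset.prod_eq_one fun j hj => ?_
          simp [Finset.ne_of_mem_erase hj]
        rw [h3, one_mul, Function.update_self] at h1
        rw [h1]
        change _ = _ * Measure.pi _ _
        rw [Measure.pi_pi, ← Finset.prod_erase_mul _ _ (Finset.mem_univ i), mul_left_comm]
        congr 1
        congr 1
        · refine Finset.prod_congr rfl fun j hj => ?_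
          have : s j = φ j := Function.update_of_ne (Finset.ne_of_mem_erase hj) _ _
          rw [this]
        · have : s i = ⟨ν, hν1⟩ := Function.update_self _ _ _
          rw [this]
      · intro j
        by_cases hj : j = i
        · subst hj; simpa using hB j
        · simp [hj]
    · rw [hap _ MeasurableSet.univ, ← occX_singleton]
      simp
  have := congrArg (fun m => m t) key
  simp only [Measure.smul_apply, smul_eq_mul] at this
  rw [← this, Measure.map_apply measurable_snd ht, Measure.restrict_apply (measurable_snd ht)]
  congr 1
  ext q
  simp [and_comm]

/-- Remark 9. -/
theorem stmt11 (w : X → ℝ) (hA : AssumptionA G) (hB : AssumptionB G w)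
    (φ : StatProfile G) (i : Fin n) (π : Strategy G i) :
    ∃ σ : Stat G i,
      (∀ ℓ : Fin (l + 1),
        J G i ℓ (combine G (ofStatAll G φ) i (ofStat G i σ)) =
          J G i ℓ (combine G (ofStatAll G φ) i π)) ∧
      (Feas G i (combine G (ofStatAll G φ) i π) →
        Feas G i (combine G (ofStatAll G φ) i (ofStat G i σ))) := by
  obtain ⟨σ, hσ⟩ := occU_disint G φ i π
  have hJ : ∀ ℓ : Fin (l + 1),
        J G i ℓ (combine G (ofStatAll G φ) i (ofStat G i σ)) =
          J G i ℓ (combine G (ofStatAll G φ) i π) := fun ℓ => by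
    rw [J_eq G w hB, J_eq G w hB, combine_stat, occU_unique G _ _ hσ]
  exact ⟨σ, hJ, fun hF ℓ hℓ => (hJ ℓ).trans_le (hF ℓ hℓ)⟩

end CSGame
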